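/- arXiv:2009.05095 — 2 statements merged into one kernel-verified Lean document; each statement's English description precedes it below -/
import Mathlib

section
/- Suppose H_N ≠ 0 for some sufficiently large N. Then for every integer m ≥ 0 there exist constants c₂ ≥ c₁ > 0 and N₀ such that for all N ≥ N₀, c₁ N^m ≤ tr(H_N^{2m})/d ≤ c₂ N^m. In particular, (1/d) Σ_{j=1}^{d} E_j^{2m} = Θ(N^m), where {E_j} are the eigenvalues of H_N counted with multiplicity. -/
open Matrix MeasureTheory Filter

/-- The space of operators on a chain of `N` qudits, each of local dimension `dloc`. -/
abbrev Op (dloc N : ℕ) := Matrix (Fin N → Fin dloc) (Fin N → Fin dloc) ℂ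

/-- Cyclic translation of qudit configurations: site `i` of the new configuration carries
the value of site `i - 1` of the old one. -/
def confShift (dloc N : ℕ) : Equiv.Perm (Fin N → Fin dloc) :=
  Equiv.arrowCongr (finRotate N) (Equiv.refl (Fin dloc))

/-- The translation operator `T` on a chain of `N` qudits, as a permutation matrix. -/
noncomputable def Tmat (dloc N : ℕ) : Op dloc N :=
  fun x y => if x = confShift dloc N y then 1 else 0

/-- Extension of an operator on the first `m` sites to the `N`-site chain, by tensoring
with the identity on the remaining sites (the zero operator if `m > N`). -/
noncomputable def embed (dloc m N : ℕ) (a : Op dloc m) : Op dloc N :=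
  if hm : m ≤ N then
    (fun x y => a (fun i => x (Fin.castLE hm i)) (fun i => y (Fin.castLE hm i)) *
      (if ∀ i : Fin N, m ≤ (i : ℕ) → x i = y i then 1 else 0))
  else 0

/-- The translation-invariant Hamiltonian `H_N = ∑_{l=0}^{N-1} T^l h T^{-l}` built from
a local term `h` on `k` sites. -/
noncomputable def Ham (dloc k N : ℕ) (h : Op dloc k) : Op dloc N :=
  ∑ l : Fin N, Tmat dloc N ^ (l : ℕ) * embed dloc k N h * (Tmat dloc N)ᴴ ^ (l : ℕ)

/-- The operator norm (ℓ²→ℓ² norm) of a matrix. -/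
noncomputable def opNorm {n : Type*} [Fintype n] [DecidableEq n] (A : Matrix n n ℂ) : ℝ :=
  ‖Matrix.toEuclideanCLM (𝕜 := ℂ) (n := n) A‖

/-- An orthonormal basis of simultaneous eigenvectors of the Hamiltonian `H` (with real
eigenvalues `E j`) and of the translation operator `T` (with eigenvalues `τ j`). -/
structure EigData (dloc N : ℕ) (H : Op dloc N) where
  v : (Fin N → Fin dloc) → ((Fin N → Fin dloc) → ℂ)
  E : (Fin N → Fin dloc) → ℝ
  τ : (Fin N → Fin dloc) → ℂ
  orth : ∀ j j', star (v j) ⬝ᵥ v j' = if j = j' then 1 else 0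
  eigH : ∀ j, H.mulVec (v j) = (E j : ℂ) • v j
  eigT : ∀ j, (Tmat dloc N).mulVec (v j) = τ j • v j

/-- The eigenstate expectation value `⟨j|B|j⟩`. -/
noncomputable def eev {dloc N : ℕ} {H : Op dloc N} (D : EigData dloc N H)
    (B : Op dloc N) (j : Fin N → Fin dloc) : ℂ :=
  star (D.v j) ⬝ᵥ B.mulVec (D.v j)

/-- `r_f(N) = ((1/d) ∑_j |⟨j|B|j⟩ - f(E_j/N)|²)^{1/2}`. -/
noncomputable def rf {dloc N : ℕ} {H : Op dloc N} (D : EigData dloc N H)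
    (B : Op dloc N) (f : ℝ → ℂ) : ℝ :=
  Real.sqrt ((1 / (dloc : ℝ) ^ N) * ∑ j, ‖eev D B j - f (D.E j / N)‖ ^ 2)

/-- A function `f : [-1,1] → {z : ℂ, |z| ≤ 1}` (encoded as a total function on `ℝ`)
is smooth with Taylor data `c0 = f(0)`, `c1 = f'(0)`, `c2 = f''(0)` and remainder
constant `M` if `|f(x) - c0 - c1 x - (c2/2) x²| ≤ M |x|³` on `[-1,1]`. -/
def SmoothFn (f : ℝ → ℂ) (c0 c1 c2 : ℂ) (M : ℝ) : Prop :=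
  0 ≤ M ∧ (∀ x ∈ Set.Icc (-1 : ℝ) 1, ‖f x‖ ≤ 1) ∧
    ∀ x ∈ Set.Icc (-1 : ℝ) 1, ‖f x - c0 - c1 * x - c2 / 2 * x ^ 2‖ ≤ M * |x| ^ 3

/-- The generalized Pauli string `X^{a_1}Z^{b_1} ⊗ ⋯ ⊗ X^{a_m}Z^{b_m}` on `m` qudits,
where `X|x⟩ = |x+1 mod dloc⟩` and `Z|x⟩ = ω^x |x⟩` with `ω = exp(2πi/dloc)`. -/
noncomputable def pauli (dloc m : ℕ) (a b : Fin m → Fin dloc) : Op dloc m :=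
  fun x y =>
    if ∀ i, (x i : ℕ) = ((y i : ℕ) + (a i : ℕ)) % dloc then
      ∏ i, Complex.exp (2 * Real.pi * Complex.I * (b i : ℕ) * (y i : ℕ) / dloc)
    else 0

/-- An operator on `k` sites is canonical if every generalized Pauli string with nonzero
coefficient in its expansion acts nontrivially on site 1. -/
def Canonical (dloc k : ℕ) (h : Op dloc k) : Prop :=
  ∀ a b : Fin k → Fin dloc,
    (∀ i : Fin k, (i : ℕ) = 0 → (a i : ℕ) = 0 ∧ (b i : ℕ) = 0) →
      Matrix.trace ((pauli dloc k a b)ᴴ * h) = 0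

/-- An operator on `k` sites is exactly `k`-local if some generalized Pauli string with
nonzero coefficient in its expansion acts nontrivially on site `k`. -/
def ExactlyLocal (dloc k : ℕ) (h : Op dloc k) : Prop :=
  ∃ a b : Fin k → Fin dloc, ∃ i : Fin k, (i : ℕ) = k - 1 ∧ ((a i : ℕ) ≠ 0 ∨ (b i : ℕ) ≠ 0) ∧
    Matrix.trace ((pauli dloc k a b)ᴴ * h) ≠ 0

/-- The submodule (over `ℝ`) of traceless operators on `k'` sites. -/
noncomputable def tracelessOps (dloc k' : ℕ) : Submodule ℝ (Op dloc k') :=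
  LinearMap.ker ((Matrix.traceLinearMap (Fin k' → Fin dloc) ℂ ℂ).restrictScalars ℝ)

/-- The translation average `𝔸 = (1/N) ∑_{l=0}^{N-1} T^l A T^{-l}` of an operator. -/
noncomputable def tavg (dloc N : ℕ) (A : Op dloc N) : Op dloc N :=
  ((N : ℂ))⁻¹ • ∑ l : Fin N, Tmat dloc N ^ (l : ℕ) * A * (Tmat dloc N)ᴴ ^ (l : ℕ)

section SiteOperators

variable {α β γ D : Type*} [Fintype α] [Fintype β] [Fintype γ] [Fintype D]
  [DecidableEq α] [DecidableEq β] [DecidableEq γ] [DecidableEq D]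

/-- Splitting a configuration into its values on the range of `e` and on the other sites. -/
noncomputable def splitConf (D : Type*) (e : α ↪ β) :
    (β → D) ≃ (α → D) × ({b // b ∉ Set.range e} → D) :=
  open Classical in
  (Equiv.piEquivPiSubtypeProd (fun b => b ∈ Set.range e) (fun _ => D)).trans
    (Equiv.prodCongr ((Equiv.ofInjective e e.injective).arrowCongr (Equiv.refl D)).symm
      (Equiv.refl _))

open scoped Kronecker in
/-- The operator `a` acting on the sites `e i`, tensored with the identity on all other sites. -/
noncomputable def siteHom (D : Type*) [Fintype D] [DecidableEq D] (e : α ↪ β) :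
    Matrix (α → D) (α → D) ℂ →⋆ₐ[ℂ] Matrix (β → D) (β → D) ℂ where
  toFun a := (a ⊗ₖ (1 : Matrix ({b // b ∉ Set.range e} → D) _ ℂ)).submatrix
    (splitConf D e) (splitConf D e)
  map_one' := by simp
  map_mul' a b := by
    rw [Matrix.submatrix_mul_equiv, ← Matrix.mul_kronecker_mul, one_mul]
  map_zero' := by simp
  map_add' a b := by simp [Matrix.add_kronecker, Matrix.submatrix_add]
  commutes' r := by
    simp [Algebra.algebraMap_eq_smul_one, Matrix.smul_kronecker, Matrix.submatrix_smul]
  map_star' a := by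
    simp [Matrix.star_eq_conjTranspose, Matrix.conjTranspose_kronecker]

open Classical in
lemma siteHom_apply (e : α ↪ β) (a : Matrix (α → D) (α → D) ℂ) (x y : β → D) :
    siteHom D e a x y =
      a (x ∘ e) (y ∘ e) * if ∀ b ∉ Set.range e, x b = y b then 1 else 0 := by
  have h1 : ∀ x : β → D, splitConf D e x = (x ∘ e, fun b => x b.1) := by
    intro x
    rfl
  change (Matrix.kroneckerMap (· * ·) a 1) (splitConf D e x) (splitConf D e y) = _
  rw [h1, h1, Matrix.kroneckerMap_apply, Matrix.one_apply]
  simp [funext_iff]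

lemma siteHom_siteHom (f : β ↪ γ) (e : α ↪ β) (a : Matrix (α → D) (α → D) ℂ) :
    siteHom D f (siteHom D e a) = siteHom D (e.trans f) a := by
  ext x y
  simp only [siteHom_apply]
  rw [mul_assoc]
  congr 1
  rw [ite_zero_mul_ite_zero, one_mul]
  refine if_congr ?_ rfl rfl
  constructor
  · rintro ⟨h1, h2⟩ c hc
    by_cases hf : c ∈ Set.range f
    · obtain ⟨b, rfl⟩ := hf
      refine h1 b ?_
      rintro ⟨i, rfl⟩
      exact hc ⟨i, rfl⟩
    · exact h2 c hf
  · intro h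
    refine ⟨fun b hb => h _ ?_, fun c hc => h _ ?_⟩
    · rintro ⟨i, hi⟩
      exact hb ⟨i, f.injective hi⟩
    · rintro ⟨i, rfl⟩
      exact hc ⟨e i, rfl⟩

open Classical in
lemma siteHom_mul_siteHom_apply (e : α ↪ γ) (f : β ↪ γ)
    (hef : Disjoint (Set.range e) (Set.range f))
    (a : Matrix (α → D) (α → D) ℂ) (b : Matrix (β → D) (β → D) ℂ) (x y : γ → D) :
    (siteHom D e a * siteHom D f b) x y =
      a (x ∘ e) (y ∘ e) * b (x ∘ f) (y ∘ f) *
        if ∀ c, c ∉ Set.range e → c ∉ Set.range f → x c = y c then 1 else 0 := by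
  have hef' : ∀ i j, e i ≠ f j := fun i j hij =>
    Set.disjoint_left.1 hef ⟨i, rfl⟩ ⟨j, hij.symm⟩
  rw [Matrix.mul_apply, Finset.sum_eq_single (fun c => if c ∈ Set.range e then y c else x c)]
  · simp only [siteHom_apply]
    have h1 : (fun c => if c ∈ Set.range e then y c else x c) ∘ e = y ∘ e := by
      ext i; simp
    have h2 : (fun c => if c ∈ Set.range e then y c else x c) ∘ f = x ∘ f := by
      ext j; simp [hef']
    rw [h1, h2, if_pos (fun c hc => by simp [hc])]
    have h3 : (∀ c ∉ Set.range f, (if c ∈ Set.range e then y c else x c) = y c) ↔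
        ∀ c, c ∉ Set.range e → c ∉ Set.range f → x c = y c := by
      refine forall_congr' fun c => ?_
      by_cases hc : c ∈ Set.range e <;> simp [hc]
    rw [if_congr h3 rfl rfl]
    ring
  · intro z _ hz
    simp only [siteHom_apply]
    by_cases h1 : ∀ c ∉ Set.range e, x c = z c
    · by_cases h2 : ∀ c ∉ Set.range f, z c = y c
      · refine absurd (funext fun c => ?_) hz
        by_cases hc : c ∈ Set.range e
        · rw [if_pos hc, h2 c (Set.disjoint_left.1 hef hc)]
        · rw [if_neg hc, h1 c hc]
      · rw [if_neg h2, mul_zero, mul_zero]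
    · rw [if_neg h1, mul_zero, zero_mul]
  · simp

lemma siteHom_commute (e : α ↪ γ) (f : β ↪ γ) (hef : Disjoint (Set.range e) (Set.range f))
    (a : Matrix (α → D) (α → D) ℂ) (b : Matrix (β → D) (β → D) ℂ) :
    Commute (siteHom D e a) (siteHom D f b) := by
  ext x y
  rw [siteHom_mul_siteHom_apply e f hef, siteHom_mul_siteHom_apply f e hef.symm,
    mul_comm (a _ _)]
  congr 1
  exact if_congr (forall_congr' fun c => ⟨fun h h1 h2 => h h2 h1, fun h h1 h2 => h h2 h1⟩) rfl rfl

/-- A tracial functional on a matrix algebra is a multiple of the trace. -/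
lemma card_mul_tracial_apply {ι : Type*} [Fintype ι] [DecidableEq ι]
    (φ : Matrix ι ι ℂ →ₗ[ℂ] ℂ) (hφ : ∀ a b, φ (a * b) = φ (b * a)) (a : Matrix ι ι ℂ) :
    (Fintype.card ι : ℂ) * φ a = φ 1 * a.trace := by
  have hoff : ∀ i j, i ≠ j → ∀ c, φ (Matrix.single i j c) = 0 := by
    intro i j hij c
    have := hφ (Matrix.single i i 1) (Matrix.single i j c)
    rwa [Matrix.single_mul_single_same, one_mul,
      Matrix.single_mul_single_of_ne _ _ _ _ hij.symm, map_zero] at this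
  have hdiag : ∀ i j c, φ (Matrix.single i i c) = φ (Matrix.single j j 1) * c := by
    intro i j c
    have := hφ (Matrix.single i j 1) (Matrix.single j i c)
    rw [Matrix.single_mul_single_same, Matrix.single_mul_single_same, one_mul, mul_one] at this
    rw [this, mul_comm, ← smul_eq_mul, ← map_smul, Matrix.smul_single, smul_eq_mul, mul_one]
  have key : ∀ j, φ a = φ (Matrix.single j j 1) * a.trace := by
    intro j
    conv_lhs => rw [Matrix.matrix_eq_sum_single a]
    simp only [map_sum]
    rw [Matrix.trace, Finset.mul_sum]
    refine Finset.sum_congr rfl fun i _ => ?_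
    rw [Finset.sum_eq_single i (fun b _ hb => hoff i b hb.symm _) (by simp), hdiag i j]
    rfl
  have h1 : φ 1 = ∑ j, φ (Matrix.single j j 1) := by
    rw [← Matrix.sum_single_one, map_sum]
  rw [h1, Finset.sum_mul, ← Finset.sum_congr rfl fun j _ => key j]
  simp

/-- A traceless operator on the sites `e i` is orthogonal to the commutant of all operators
on these sites. -/
lemma trace_siteHom_mul_eq_zero [Nonempty D] (e : α ↪ β) (a : Matrix (α → D) (α → D) ℂ)
    (ha : a.trace = 0) (B : Matrix (β → D) (β → D) ℂ)
    (hB : ∀ u, Commute (siteHom D e u) B) : (siteHom D e a * B).trace = 0 := by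
  let φ : Matrix (α → D) (α → D) ℂ →ₗ[ℂ] ℂ :=
    Matrix.traceLinearMap _ ℂ ℂ ∘ₗ LinearMap.mulRight ℂ B ∘ₗ (siteHom D e).toAlgHom.toLinearMap
  have hφ : ∀ u, φ u = (siteHom D e u * B).trace := fun u => rfl
  have := card_mul_tracial_apply φ (fun u v => by
    rw [hφ, hφ, map_mul, map_mul, mul_assoc, Matrix.trace_mul_comm, mul_assoc, ← (hB u).eq,
      mul_assoc]) a
  rw [ha, mul_zero] at this
  exact (mul_eq_zero.1 this).resolve_left (Nat.cast_ne_zero.2 Fintype.card_ne_zero)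

lemma trace_siteHom [Nonempty D] (e : α ↪ β) (a : Matrix (α → D) (α → D) ℂ) :
    (siteHom D e a).trace / (Fintype.card D : ℂ) ^ Fintype.card β =
      a.trace / (Fintype.card D : ℂ) ^ Fintype.card α := by
  let φ : Matrix (α → D) (α → D) ℂ →ₗ[ℂ] ℂ :=
    Matrix.traceLinearMap _ ℂ ℂ ∘ₗ (siteHom D e).toAlgHom.toLinearMap
  have hφ : ∀ u, φ u = (siteHom D e u).trace := fun u => rfl
  have := card_mul_tracial_apply φ (fun u v => by
    rw [hφ, hφ, map_mul, map_mul, Matrix.trace_mul_comm]) a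
  rw [hφ, hφ, map_one, Matrix.trace_one, Fintype.card_fun, Fintype.card_fun] at this
  push_cast at this
  have hD : (Fintype.card D : ℂ) ≠ 0 := Nat.cast_ne_zero.2 Fintype.card_ne_zero
  rw [div_eq_div_iff (pow_ne_zero _ hD) (pow_ne_zero _ hD), mul_comm, this, mul_comm]

open scoped Matrix.Norms.L2Operator in
lemma norm_siteHom_le (e : α ↪ β) (a : Matrix (α → D) (α → D) ℂ) :
    ‖siteHom D e a‖ ≤ ‖a‖ :=
  NonUnitalStarAlgHom.norm_apply_le (siteHom D e) a

open scoped Matrix.Norms.L2Operator in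
lemma norm_trace_le {ι : Type*} [Fintype ι] [DecidableEq ι] (A : Matrix ι ι ℂ) :
    ‖A.trace‖ ≤ Fintype.card ι * ‖A‖ := by
  have hentry : ∀ i, ‖A i i‖ ≤ ‖A‖ := by
    intro i
    have h1 := Matrix.l2_opNorm_mulVec A (EuclideanSpace.single i (1 : ℂ))
    rw [PiLp.norm_single, norm_one, mul_one] at h1
    refine le_trans ?_ h1
    have h2 := PiLp.norm_apply_le ((EuclideanSpace.equiv ι ℂ).symm
      (A *ᵥ (EuclideanSpace.single i (1 : ℂ)))) i
    simpa using h2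
  calc ‖A.trace‖ ≤ ∑ i, ‖A i i‖ := norm_sum_le _ _
    _ ≤ ∑ _i : ι, ‖A‖ := Finset.sum_le_sum fun i _ => hentry i
    _ = Fintype.card ι * ‖A‖ := by simp

end SiteOperators

section Chain

lemma indicator_congr {P Q : Prop} {dP : Decidable P} {dQ : Decidable Q} (h : P ↔ Q) :
    (if P then (1 : ℂ) else 0) = if Q then 1 else 0 :=
  if_congr h rfl rfl

variable {dloc k N : ℕ}

lemma Tmat_conj_apply (A : Op dloc N) (x y : Fin N → Fin dloc) :
    (Tmat dloc N * A * (Tmat dloc N)ᴴ) x y =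
      A ((confShift dloc N).symm x) ((confShift dloc N).symm y) := by
  have hT : ∀ u v, Tmat dloc N u v = if v = (confShift dloc N).symm u then 1 else 0 := by
    intro u v
    refine if_congr ?_ rfl rfl
    rw [Equiv.eq_symm_apply, eq_comm]
  simp [Matrix.mul_apply, Matrix.conjTranspose_apply, hT]

lemma Tmat_conj_siteHom (e : Fin k ↪ Fin N) (a : Op dloc k) :
    Tmat dloc N * siteHom (Fin dloc) e a * (Tmat dloc N)ᴴ =
      siteHom (Fin dloc) (e.trans (finRotate N).toEmbedding) a := by
  ext x y
  have hs : ∀ x, (confShift dloc N).symm x = x ∘ finRotate N := fun x => rfl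
  rw [Tmat_conj_apply, siteHom_apply, siteHom_apply, hs, hs]
  refine congrArg₂ _ rfl (indicator_congr ?_)
  constructor
  · intro h b hb
    obtain ⟨b, rfl⟩ := (finRotate N).surjective b
    exact h b (fun ⟨i, hi⟩ => hb ⟨i, congrArg (finRotate N) hi⟩)
  · intro h b hb
    exact h _ (fun ⟨i, hi⟩ => hb ⟨i, (finRotate N).injective hi⟩)

/-- The inclusion of `k` consecutive sites starting at site `l` of a periodic chain. -/
def window (hkN : k ≤ N) [NeZero N] (l : Fin N) : Fin k ↪ Fin N :=
  (Fin.castLEEmb hkN).trans (Equiv.addRight l).toEmbedding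

lemma window_apply (hkN : k ≤ N) [NeZero N] (l : Fin N) (i : Fin k) :
    window hkN l i = Fin.castLE hkN i + l := rfl

lemma embed_eq_siteHom (hkN : k ≤ N) (a : Op dloc k) :
    embed dloc k N a = siteHom (Fin dloc) (Fin.castLEEmb hkN) a := by
  ext x y
  have he : embed dloc k N a x y =
      a (fun i => x (Fin.castLE hkN i)) (fun i => y (Fin.castLE hkN i)) *
        (if ∀ i : Fin N, k ≤ (i : ℕ) → x i = y i then 1 else 0) := by
    rw [show embed dloc k N a = _ from dif_pos hkN]
  rw [siteHom_apply, he]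
  refine congrArg₂ _ rfl (indicator_congr ?_)
  refine forall_congr' fun i => imp_congr_left ?_
  constructor
  · rintro hi ⟨j, rfl⟩
    exact absurd j.2 (not_lt.2 hi)
  · intro hi
    by_contra hlt
    exact hi ⟨⟨i, not_le.1 hlt⟩, rfl⟩

lemma Tmat_pow_conj_embed (hkN : k ≤ N) [NeZero N] (a : Op dloc k) (l : ℕ) :
    Tmat dloc N ^ l * embed dloc k N a * (Tmat dloc N)ᴴ ^ l =
      siteHom (Fin dloc) (window hkN (Fin.ofNat N l)) a := by
  induction l with
  | zero =>
    rw [pow_zero, pow_zero, one_mul, mul_one, embed_eq_siteHom hkN]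
    congr 2
    ext i
    simp [window_apply]
  | succ l ih =>
    rw [pow_succ', pow_succ, show ∀ A B C D E : Op dloc N, A * B * C * (D * E) = A * (B * C * D) * E
      from fun A B C D E => by simp only [mul_assoc], ih, Tmat_conj_siteHom]
    congr 2
    ext i
    obtain ⟨n, rfl⟩ := Nat.exists_eq_succ_of_ne_zero (NeZero.ne N)
    simp [window_apply, Fin.val_add, Fin.ofNat, Nat.add_assoc]

lemma Ham_eq_sum_siteHom (hkN : k ≤ N) [NeZero N] (h : Op dloc k) :
    Ham dloc k N h = ∑ l : Fin N, siteHom (Fin dloc) (window hkN l) h := by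
  refine Finset.sum_congr rfl fun l _ => ?_
  rw [Tmat_pow_conj_embed hkN, show Fin.ofNat N (l : ℕ) = l from
    Fin.ext (Nat.mod_eq_of_lt l.isLt)]

end Chain

section Moments

/-- Expansion of a power of a sum of noncommuting elements. -/
lemma sum_pow_eq_sum_prod_ofFn {R V : Type*} [Semiring R] [Fintype V] (a : V → R) (n : ℕ) :
    (∑ l, a l) ^ n = ∑ f : Fin n → V, (List.ofFn fun i => a (f i)).prod := by
  induction n with
  | zero => simp
  | succ n ih =>
    rw [pow_succ', ih, Finset.sum_mul_sum, ← Finset.sum_product',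
      ← (Fin.consEquiv fun _ => V).sum_comp]
    refine Finset.sum_congr rfl fun p _ => ?_
    simp [List.ofFn_succ, Fin.consEquiv]

lemma exists_prod_ofFn_eq_mul_mul {R : Type*} [Monoid R] {n : ℕ} (a : Fin n → R) (i : Fin n) :
    ∃ A B : R, (List.ofFn a).prod = A * a i * B ∧
      ∀ u, (∀ j, j ≠ i → Commute u (a j)) → Commute u A ∧ Commute u B := by
  induction n with
  | zero => exact i.elim0
  | succ n ih =>
    rw [List.ofFn_succ, List.prod_cons]
    cases i using Fin.cases with
    | zero =>
      refine ⟨1, _, by rw [one_mul], fun u hu => ⟨Commute.one_right u, ?_⟩⟩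
      refine Commute.list_prod_right _ _ fun x hx => ?_
      obtain ⟨j, rfl⟩ := (List.mem_ofFn' _ _).1 hx
      exact hu _ (Fin.succ_ne_zero j)
    | succ i =>
      obtain ⟨A, B, hAB, hcomm⟩ := ih (fun j => a j.succ) i
      refine ⟨a 0 * A, B, by rw [hAB]; simp only [mul_assoc], fun u hu => ?_⟩
      obtain ⟨hA, hB⟩ := hcomm u fun j hj => hu _ fun h => hj (Fin.succ_injective _ h)
      exact ⟨(hu 0 (Fin.succ_ne_zero i).symm).mul_right hA, hB⟩

/-- In a graph without isolated vertices on at most `2 * m` vertices there is a dominating set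
with at most `m` elements. -/
lemma exists_dominating_finset {ι : Type*} [Fintype ι] [DecidableEq ι] (m : ℕ)
    (hι : Fintype.card ι ≤ 2 * m) (r : ι → ι → Prop) (hr : ∀ i j, r i j → r j i)
    (hiso : ∀ i, ∃ j, j ≠ i ∧ r i j) :
    ∃ R : Finset ι, R.card ≤ m ∧ ∀ i ∉ R, ∃ j ∈ R, r j i := by
  classical
  obtain ⟨R, hR⟩ : ∃ R : Finset ι,
      Maximal (fun R : Finset ι => ∀ i ∈ R, ∀ j ∈ R, i ≠ j → ¬ r i j) R :=
    (Set.toFinite {R : Finset ι | ∀ i ∈ R, ∀ j ∈ R, i ≠ j → ¬ r i j}).exists_maximal ⟨∅, by simp⟩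
  have hdom : ∀ i ∉ R, ∃ j ∈ R, r j i := by
    intro i hi
    by_contra! hno
    refine hi (hR.2 (y := insert i R) ?_ (Finset.subset_insert i R) (Finset.mem_insert_self i R))
    intro a ha b hb hab hrab
    rcases Finset.mem_insert.1 ha with rfl | ha' <;> rcases Finset.mem_insert.1 hb with rfl | hb'
    · exact hab rfl
    · exact hno b hb' (hr _ _ hrab)
    · exact hno a ha' hrab
    · exact hR.1 a ha' b hb' hab hrab
  by_cases hcard : R.card ≤ m
  · exact ⟨R, hcard, hdom⟩
  · refine ⟨Rᶜ, by rw [Finset.card_compl]; omega, fun i hi => ?_⟩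
    rw [Finset.mem_compl, not_not] at hi
    obtain ⟨j, hj, hij⟩ := hiso i
    exact ⟨j, Finset.mem_compl.2 fun hjR => hR.1 i hi j hjR hj.symm hij, hr _ _ hij⟩

lemma exists_fin_cover {ι : Type*} {m : ℕ} (hm : m ≠ 0 → Nonempty ι) (R : Finset ι)
    (hR : R.card ≤ m) : ∃ q : Fin m → ι, ∀ i ∈ R, ∃ s, q s = i := by
  rcases eq_or_ne m 0 with rfl | h0
  · refine ⟨Fin.elim0, fun i hi => ?_⟩
    rw [Finset.card_eq_zero.1 (Nat.le_zero.1 hR)] at hi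
    simp at hi
  · obtain ⟨c⟩ := hm h0
    refine ⟨fun s => if hs : s.1 < R.card then (R.equivFin.symm ⟨s, hs⟩).1 else c, fun i hi => ?_⟩
    refine ⟨⟨R.equivFin ⟨i, hi⟩, (R.equivFin ⟨i, hi⟩).2.trans_le hR⟩, ?_⟩
    simp

open Classical in
/-- The number of tuples of length `2 * m` in which every entry has a neighbour among the other
entries grows at most like the `m`-th power of the number of vertices, if the neighbours of each
vertex `v` are among the `nbr v t`. -/
lemma card_tuples_without_isolated_le {V T : Type*} [Fintype V] [Fintype T] (m : ℕ)
    (r : V → V → Prop) (hr : ∀ u v, r u v → r v u) (nbr : V → T → V)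
    (hnbr : ∀ u v, r u v → ∃ t, nbr u t = v) :
    (Finset.univ.filter fun f : Fin (2 * m) → V =>
      ∀ i, ∃ j, j ≠ i ∧ r (f i) (f j)).card ≤
      Fintype.card V ^ m * (m ^ (2 * m) * (Fintype.card T + 1) ^ (2 * m)) := by
  let F : (Fin m → V) × (Fin (2 * m) → Fin m) × (Fin (2 * m) → Option T) → Fin (2 * m) → V :=
    fun p i => (p.2.2 i).elim (p.1 (p.2.1 i)) (nbr (p.1 (p.2.1 i)))
  have hcard : Fintype.card ((Fin m → V) × (Fin (2 * m) → Fin m) × (Fin (2 * m) → Option T)) =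
      Fintype.card V ^ m * (m ^ (2 * m) * (Fintype.card T + 1) ^ (2 * m)) := by
    simp
  rw [← hcard, ← Finset.card_univ]
  refine Finset.card_le_card_of_surjOn F fun f hf => ?_
  have hf' : ∀ i, ∃ j, j ≠ i ∧ r (f i) (f j) := by simpa using hf
  obtain ⟨R, hR, hdom⟩ := exists_dominating_finset m (by simp) (fun i j => r (f i) (f j))
    (fun i j => hr _ _) hf'
  obtain ⟨q, hq⟩ := exists_fin_cover (fun h0 => ⟨⟨0, by omega⟩⟩) R hR
  have hsol : ∀ i, ∃ s : Fin m, ∃ t : Option T, t.elim (f (q s)) (nbr (f (q s))) = f i := by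
    intro i
    by_cases hi : i ∈ R
    · obtain ⟨s, rfl⟩ := hq i hi
      exact ⟨s, none, rfl⟩
    · obtain ⟨j, hj, hji⟩ := hdom i hi
      obtain ⟨s, rfl⟩ := hq j hj
      obtain ⟨t, ht⟩ := hnbr _ _ hji
      exact ⟨s, some t, ht⟩
  choose s t hst using hsol
  exact ⟨(f ∘ q, s, t), by simp, funext hst⟩

end Moments

section UpperBound

variable {dloc k N : ℕ}

lemma trace_prod_window_eq_zero [NeZero dloc] (hkN : k ≤ N) [NeZero N] (h : Op dloc k)
    (htr : h.trace = 0) {n : ℕ} (f : Fin n → Fin N) (i : Fin n)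
    (hi : ∀ j, j ≠ i → Disjoint (Set.range (window hkN (f i))) (Set.range (window hkN (f j)))) :
    (List.ofFn fun j => siteHom (Fin dloc) (window hkN (f j)) h).prod.trace = 0 := by
  obtain ⟨A, B, hAB, hcomm⟩ :=
    exists_prod_ofFn_eq_mul_mul (fun j => siteHom (Fin dloc) (window hkN (f j)) h) i
  rw [hAB, mul_assoc, Matrix.trace_mul_comm, mul_assoc]
  refine trace_siteHom_mul_eq_zero _ h htr _ fun u => ?_
  obtain ⟨hA, hB⟩ := hcomm (siteHom (Fin dloc) (window hkN (f i)) u)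
    fun j hj => siteHom_commute _ _ (hi j hj) u h
  exact hB.mul_right hA

open scoped Matrix.Norms.L2Operator in
lemma norm_trace_prod_window_le (hkN : k ≤ N) [NeZero N] (h : Op dloc k)
    (hnorm : opNorm h ≤ 1) {n : ℕ} (f : Fin n → Fin N) :
    ‖(List.ofFn fun j => siteHom (Fin dloc) (window hkN (f j)) h).prod.trace‖ ≤
      (dloc : ℝ) ^ N := by
  rcases isEmpty_or_nonempty (Fin N → Fin dloc) with hE | hE
  · simp [Matrix.trace]
  refine (norm_trace_le _).trans ?_
  have hprod : ‖(List.ofFn fun j => siteHom (Fin dloc) (window hkN (f j)) h).prod‖ ≤ 1 := by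
    refine (List.norm_prod_le _).trans ?_
    rw [List.map_ofFn, List.prod_ofFn]
    exact Finset.prod_le_one (fun _ _ => norm_nonneg _)
      fun j _ => (norm_siteHom_le _ h).trans hnorm
  simpa using mul_le_mul_of_nonneg_left hprod (Nat.cast_nonneg (Fintype.card (Fin N → Fin dloc)))

lemma norm_trace_Ham_pow_le [NeZero dloc] (hkN : k ≤ N) [NeZero N] (h : Op dloc k)
    (htr : h.trace = 0) (hnorm : opNorm h ≤ 1) (m : ℕ) :
    ‖(Ham dloc k N h ^ (2 * m)).trace‖ ≤
      ((m ^ (2 * m) * (k * k + 1) ^ (2 * m) : ℕ) : ℝ) * (N : ℝ) ^ m * (dloc : ℝ) ^ N := by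
  classical
  let r : Fin N → Fin N → Prop := fun l l' =>
    ¬ Disjoint (Set.range (window (k := k) hkN l)) (Set.range (window (k := k) hkN l'))
  let s : Finset (Fin (2 * m) → Fin N) :=
    Finset.univ.filter fun f => ∀ i, ∃ j, j ≠ i ∧ r (f i) (f j)
  have hs : s.card ≤ N ^ m * (m ^ (2 * m) * (k * k + 1) ^ (2 * m)) := by
    have := card_tuples_without_isolated_le (V := Fin N) (T := Fin k × Fin k) m r
      (fun u v huv hvu => huv hvu.symm)
      (fun l t => Fin.castLE hkN t.1 + l - Fin.castLE hkN t.2)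
      (fun u v huv => by
        obtain ⟨_, ⟨i, rfl⟩, ⟨j, hj⟩⟩ := Set.not_disjoint_iff.1 huv
        refine ⟨(i, j), ?_⟩
        rw [window_apply, window_apply] at hj
        simp [← hj])
    simpa using this
  rw [Ham_eq_sum_siteHom hkN, sum_pow_eq_sum_prod_ofFn, Matrix.trace_sum,
    ← Finset.sum_subset (Finset.subset_univ s)]
  · calc _ ≤ ∑ _f ∈ s, (dloc : ℝ) ^ N :=
          (norm_sum_le _ _).trans
            (Finset.sum_le_sum fun f _ => norm_trace_prod_window_le hkN h hnorm f)
      _ = (s.card : ℝ) * (dloc : ℝ) ^ N := by rw [Finset.sum_const, nsmul_eq_mul]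
      _ ≤ ((N ^ m * (m ^ (2 * m) * (k * k + 1) ^ (2 * m)) : ℕ) : ℝ) * (dloc : ℝ) ^ N := by
          gcongr
      _ = _ := by push_cast; ring
  · intro f _ hf
    simp only [s, r, Finset.mem_filter, Finset.mem_univ, true_and] at hf
    push Not at hf
    obtain ⟨i, hi⟩ := hf
    exact trace_prod_window_eq_zero hkN h htr f i hi

end UpperBound

section SecondMoment

variable {dloc k : ℕ}

lemma trace_siteHom_mul_siteHom_trans [NeZero dloc] {n M N : ℕ} (σ : Fin M ↪ Fin N)
    (e f : Fin n ↪ Fin M) (a b : Op dloc n) :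
    (siteHom (Fin dloc) (e.trans σ) a * siteHom (Fin dloc) (f.trans σ) b).trace /
        (dloc : ℂ) ^ N =
      (siteHom (Fin dloc) e a * siteHom (Fin dloc) f b).trace / (dloc : ℂ) ^ M := by
  rw [← siteHom_siteHom, ← siteHom_siteHom, ← map_mul]
  simpa using trace_siteHom σ (siteHom (Fin dloc) e a * siteHom (Fin dloc) f b)

/-- The normalized correlation of two translates of `h` in a chain of `N` sites. -/
noncomputable def corr (h : Op dloc k) {N : ℕ} [NeZero N] (hkN : k ≤ N) (l l' : Fin N) : ℂ :=
  (siteHom (Fin dloc) (window hkN l) h * siteHom (Fin dloc) (window hkN l') h).trace /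
    (dloc : ℂ) ^ N

lemma corr_comm (h : Op dloc k) {N : ℕ} [NeZero N] (hkN : k ≤ N) (l l' : Fin N) :
    corr h hkN l l' = corr h hkN l' l := by
  rw [corr, corr, Matrix.trace_mul_comm]

lemma corr_add [NeZero dloc] (h : Op dloc k) {N : ℕ} [NeZero N] (hkN : k ≤ N) (l l' s : Fin N) :
    corr h hkN (l + s) (l' + s) = corr h hkN l l' := by
  have hw : ∀ l, window (k := k) hkN (l + s) =
      (window hkN l).trans (Equiv.addRight s).toEmbedding := by
    intro l
    ext i
    simp [window_apply, add_assoc]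
  rw [corr, hw, hw, trace_siteHom_mul_siteHom_trans]
  rfl

lemma corr_eq_zero [NeZero dloc] (h : Op dloc k) (htr : h.trace = 0) {N : ℕ} [NeZero N]
    (hkN : k ≤ N) (s : Fin N) (h1 : k ≤ s) (h2 : s + k ≤ N) : corr h hkN 0 s = 0 := by
  rw [corr, trace_siteHom_mul_eq_zero _ h htr _ fun u => siteHom_commute _ _ ?_ u h, zero_div]
  rw [Set.disjoint_left]
  rintro _ ⟨i, rfl⟩ ⟨j, hj⟩
  have := congrArg Fin.val hj
  rw [window_apply, window_apply, Fin.val_add, Fin.val_add, Nat.mod_eq_of_lt] at this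
  · simp only [Fin.val_castLE, Fin.val_zero, add_zero] at this
    rw [Nat.mod_eq_of_lt (i.2.trans_le hkN)] at this
    omega
  · simp only [Fin.val_castLE]
    omega

lemma corr_castLE [NeZero dloc] (h : Op dloc k) {M N : ℕ} [NeZero M] [NeZero N]
    (hkM : k ≤ M) (hMN : M ≤ N) (s : Fin M) (hs : s + k ≤ M) :
    corr h (hkM.trans hMN) 0 (Fin.castLE hMN s) = corr h hkM 0 s := by
  have hw : ∀ t : Fin M, t + k ≤ M → window (k := k) (hkM.trans hMN) (Fin.castLE hMN t) =
      (window hkM t).trans (Fin.castLEEmb hMN) := by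
    intro t ht
    ext i
    simp only [window_apply, Function.Embedding.trans_apply, Fin.castLEEmb_apply, Fin.val_castLE,
      Fin.val_add]
    rw [Nat.mod_eq_of_lt (by omega), Nat.mod_eq_of_lt (by omega)]
  have h0 := hw 0 (by simpa using hkM)
  rw [show Fin.castLE hMN 0 = (0 : Fin N) from Fin.ext (by simp)] at h0
  rw [corr, hw s hs, h0, trace_siteHom_mul_siteHom_trans]
  rfl

lemma trace_Ham_sq [NeZero dloc] (h : Op dloc k) {N : ℕ} [NeZero N] (hkN : k ≤ N) :
    (Ham dloc k N h ^ 2).trace / (dloc : ℂ) ^ N = N * ∑ s : Fin N, corr h hkN 0 s := by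
  rw [Ham_eq_sum_siteHom hkN, sq, Finset.sum_mul_sum, Matrix.trace_sum, Finset.sum_div]
  have : ∀ l : Fin N, (∑ l' : Fin N, siteHom (Fin dloc) (window hkN l) h *
      siteHom (Fin dloc) (window hkN l') h).trace / (dloc : ℂ) ^ N =
      ∑ s : Fin N, corr h hkN 0 s := by
    intro l
    rw [Matrix.trace_sum, Finset.sum_div, ← Equiv.sum_comp (Equiv.addRight l)]
    refine Finset.sum_congr rfl fun s _ => ?_
    rw [← corr_add h hkN 0 s l, zero_add]
    rfl
  rw [Finset.sum_congr rfl fun l _ => this l]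
  simp

/-- The normalized second moment is exactly linear in the number of sites. -/
lemma exists_trace_Ham_sq_eq [NeZero dloc] (hk : 1 ≤ k) (h : Op dloc k) (htr : h.trace = 0) :
    ∃ c : ℂ, ∀ N, 2 * k ≤ N → (Ham dloc k N h ^ 2).trace / (dloc : ℂ) ^ N = N * c := by
  have : NeZero (2 * k) := ⟨by omega⟩
  have hk2 : k ≤ 2 * k := by omega
  let g : ℕ → ℂ := fun t => corr h hk2 0 (Fin.ofNat (2 * k) t)
  refine ⟨∑ t ∈ Finset.range k, g t + ∑ t ∈ Finset.range (k - 1), g (k - 1 - t), fun N hN => ?_⟩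
  have : NeZero N := ⟨by omega⟩
  have hkN : k ≤ N := hk2.trans hN
  have hsmall : ∀ s : Fin N, (s : ℕ) < k → corr h hkN 0 s = g s := by
    intro s hs
    change _ = corr h hk2 0 (Fin.ofNat (2 * k) s)
    rw [← corr_castLE h hk2 hN _ (by
      simp only [Fin.ofNat]
      rw [Nat.mod_eq_of_lt (by omega)]
      omega)]
    congr 1
    ext
    simp only [Fin.ofNat, Fin.val_castLE]
    rw [Nat.mod_eq_of_lt (by omega)]
  have hlarge : ∀ s : Fin N, N < s + k → corr h hkN 0 s = g (N - s) := by
    intro s hs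
    rw [← corr_add h hkN 0 s (-s), zero_add, add_neg_cancel, corr_comm]
    have hval : ((-s : Fin N) : ℕ) = N - s := by
      rw [Fin.val_neg', Nat.mod_eq_of_lt]
      omega
    rw [hsmall (-s) (by rw [hval]; omega), hval]
  rw [trace_Ham_sq h hkN]
  congr 1
  let G : ℕ → ℂ := fun t => corr h hkN 0 (Fin.ofNat N t)
  have hG : ∀ s : Fin N, corr h hkN 0 s = G s := by
    intro s
    rw [show s = Fin.ofNat N (s : ℕ) from Fin.ext (Nat.mod_eq_of_lt s.isLt).symm]
    simp [G, Fin.ofNat]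
  rw [Finset.sum_congr rfl fun s _ => hG s, Fin.sum_univ_eq_sum_range G N]
  have hN' : N = k + (N + 1 - 2 * k) + (k - 1) := by omega
  have hsplit : ∑ t ∈ Finset.range N, G t = ∑ t ∈ Finset.range k, G t +
      ∑ t ∈ Finset.range (N + 1 - 2 * k), G (k + t) +
      ∑ t ∈ Finset.range (k - 1), G (k + (N + 1 - 2 * k) + t) := by
    rw [← Finset.sum_range_add, ← Finset.sum_range_add, ← hN']
  rw [hsplit]
  have h1 : ∀ t ∈ Finset.range k, G t = g t := by
    intro t ht
    have ht' : t < N := (Finset.mem_range.1 ht).trans_le hkN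
    exact (hG ⟨t, ht'⟩).symm.trans (hsmall ⟨t, ht'⟩ (Finset.mem_range.1 ht))
  have h2 : ∀ t ∈ Finset.range (N + 1 - 2 * k), G (k + t) = 0 := by
    intro t ht
    have ht1 := Finset.mem_range.1 ht
    have ht' : k + t < N := by omega
    exact (hG ⟨k + t, ht'⟩).symm.trans
      (corr_eq_zero h htr hkN ⟨k + t, ht'⟩ (by simp) (by simp only; omega))
  have h3 : ∀ t ∈ Finset.range (k - 1), G (k + (N + 1 - 2 * k) + t) = g (k - 1 - t) := by
    intro t ht
    have ht1 := Finset.mem_range.1 ht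
    have ht' : k + (N + 1 - 2 * k) + t < N := by omega
    refine (hG ⟨_, ht'⟩).symm.trans ((hlarge ⟨_, ht'⟩ (by simp only; omega)).trans ?_)
    congr 1
    simp only
    omega
  rw [Finset.sum_congr rfl h1, Finset.sum_congr rfl h2, Finset.sum_congr rfl h3,
    Finset.sum_const_zero, add_zero]

end SecondMoment

section Spectrum

variable {dloc N : ℕ} {H : Op dloc N}

lemma EigData.exists_diagonalization (D : EigData dloc N H) :
    ∃ U : Op dloc N, Uᴴ * U = 1 ∧ H = U * Matrix.diagonal (fun j => (D.E j : ℂ)) * Uᴴ := by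
  let U : Op dloc N := Matrix.of fun x j => D.v j x
  have hU : Uᴴ * U = 1 := by
    ext i j
    rw [Matrix.one_apply, ← D.orth i j]
    rfl
  refine ⟨U, hU, ?_⟩
  have hHU : H * U = U * Matrix.diagonal (fun j => (D.E j : ℂ)) := by
    ext x j
    rw [Matrix.mul_diagonal]
    have := congrFun (D.eigH j) x
    rw [Pi.smul_apply, smul_eq_mul, mul_comm] at this
    exact this
  rw [← hHU, mul_assoc, mul_eq_one_comm.1 hU, mul_one]

lemma EigData.trace_pow (D : EigData dloc N H) (p : ℕ) :
    (H ^ p).trace = ∑ j, (D.E j : ℂ) ^ p := by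
  obtain ⟨U, hU, hH⟩ := D.exists_diagonalization
  have hpow : ∀ A : Op dloc N, H = U * A * Uᴴ → H ^ p = U * A ^ p * Uᴴ := by
    intro A hA
    induction p with
    | zero => simp [mul_eq_one_comm.1 hU]
    | succ p ih =>
      rw [pow_succ, ih, hA, show ∀ A B C E F : Op dloc N,
        A * B * C * (A * E * F) = A * B * (C * A) * E * F from
          fun A B C E F => by simp only [mul_assoc], hU, mul_one, pow_succ]
      simp only [mul_assoc]
  rw [hpow _ hH, Matrix.trace_mul_comm, ← mul_assoc, hU, one_mul, Matrix.diagonal_pow,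
    Matrix.trace_diagonal]
  rfl

lemma EigData.trace_pow_div (D : EigData dloc N H) (p : ℕ) :
    (H ^ p).trace / (dloc : ℂ) ^ N =
      (((1 / (dloc : ℝ) ^ N) * ∑ j, D.E j ^ p : ℝ) : ℂ) := by
  rw [D.trace_pow]
  push_cast
  ring

lemma EigData.sum_sq_pos (D : EigData dloc N H) (hH : H ≠ 0) : 0 < ∑ j, D.E j ^ 2 := by
  refine lt_of_le_of_ne (Finset.sum_nonneg fun j _ => sq_nonneg _) fun h0 => hH ?_
  have hE : ∀ j, D.E j = 0 := fun j => pow_eq_zero_iff two_ne_zero |>.1 <|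
    (Finset.sum_eq_zero_iff_of_nonneg fun j _ => sq_nonneg (D.E j)).1 h0.symm j (Finset.mem_univ j)
  obtain ⟨U, -, hU⟩ := D.exists_diagonalization
  rw [hU]
  simp [hE]

lemma EigData.pow_second_moment_le [NeZero dloc] (D : EigData dloc N H) (m : ℕ) :
    ((1 / (dloc : ℝ) ^ N) * ∑ j, D.E j ^ 2) ^ m ≤
      (1 / (dloc : ℝ) ^ N) * ∑ j, D.E j ^ (2 * m) := by
  have hd : (dloc : ℝ) ≠ 0 := Nat.cast_ne_zero.2 (NeZero.ne dloc)
  have := Real.pow_arith_mean_le_arith_mean_pow Finset.univ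
    (fun _ : Fin N → Fin dloc => 1 / (dloc : ℝ) ^ N) (fun j => D.E j ^ 2)
    (fun _ _ => by positivity) (by simp [hd]) (fun _ _ => sq_nonneg _) m
  simpa only [Finset.mul_sum, pow_mul] using this

end Spectrum

/-- moments: If `H_N ≠ 0` for some sufficiently large `N`, then for every
`m ≥ 0` one has `tr(H_N^{2m})/d = (1/d) ∑_j E_j^{2m} = Θ(N^m)`. -/
theorem trace_even_moments (dloc k : ℕ) (hdloc : 2 ≤ dloc) (hk : 1 ≤ k)
    (h : Op dloc k) (hherm : h.IsHermitian) (htr : h.trace = 0) (hnorm : opNorm h = 1)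
    (D : ∀ N, EigData dloc N (Ham dloc k N h))
    (hH : ∀ N₀ : ℕ, ∃ N : ℕ, N₀ ≤ N ∧ Ham dloc k N h ≠ 0) :
    ∀ m : ℕ, ∃ c₁ c₂ : ℝ, 0 < c₁ ∧ c₁ ≤ c₂ ∧ ∃ N₀ : ℕ, ∀ N : ℕ, N₀ ≤ N →
      ((Ham dloc k N h ^ (2 * m)).trace / (dloc : ℂ) ^ N =
          (((1 / (dloc : ℝ) ^ N) * ∑ j, (D N).E j ^ (2 * m) : ℝ) : ℂ)) ∧
      c₁ * (N : ℝ) ^ m ≤ (1 / (dloc : ℝ) ^ N) * ∑ j, (D N).E j ^ (2 * m) ∧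
      (1 / (dloc : ℝ) ^ N) * ∑ j, (D N).E j ^ (2 * m) ≤ c₂ * (N : ℝ) ^ m := by
  have : NeZero dloc := ⟨by omega⟩
  intro m
  obtain ⟨c, hc⟩ := exists_trace_Ham_sq_eq hk h htr
  obtain ⟨N₁, hN₁, hH₁⟩ := hH (2 * k)
  have hdpos : ∀ N, (0 : ℝ) < (dloc : ℝ) ^ N := fun N =>
    pow_pos (Nat.cast_pos.2 (by omega)) N
  have hN₁pos : (0 : ℝ) < N₁ := Nat.cast_pos.2 (by omega)
  obtain ⟨c', hc'pos, hc'⟩ : ∃ c' : ℝ, 0 < c' ∧ c = c' := by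
    refine ⟨(1 / (dloc : ℝ) ^ N₁ * ∑ j, (D N₁).E j ^ 2) / N₁, ?_, ?_⟩
    · have := (D N₁).sum_sq_pos hH₁
      have := hdpos N₁
      positivity
    · rw [Complex.ofReal_div, ← (D N₁).trace_pow_div 2, hc N₁ hN₁, Complex.ofReal_natCast,
        mul_div_cancel_left₀]
      exact_mod_cast hN₁pos.ne'
  have hsecond : ∀ N, 2 * k ≤ N → 1 / (dloc : ℝ) ^ N * ∑ j, (D N).E j ^ 2 = N * c' := by
    intro N hN
    have := hc N hN
    rw [(D N).trace_pow_div 2, hc'] at this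
    exact_mod_cast this
  set C : ℝ := ((m ^ (2 * m) * (k * k + 1) ^ (2 * m) : ℕ) : ℝ)
  refine ⟨c' ^ m, max (c' ^ m) C, by positivity, le_max_left _ _, 2 * k, fun N hN =>
    ⟨(D N).trace_pow_div (2 * m), ?_, ?_⟩⟩
  · calc c' ^ m * (N : ℝ) ^ m = (N * c') ^ m := by ring
      _ ≤ _ := by rw [← hsecond N hN]; exact (D N).pow_second_moment_le m
  · have : NeZero N := ⟨by omega⟩
    have hub := norm_trace_Ham_pow_le (N := N) (by omega) h htr hnorm.le m
    calc _ ≤ ‖(((1 / (dloc : ℝ) ^ N) * ∑ j, (D N).E j ^ (2 * m) : ℝ) : ℂ)‖ := by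
          rw [Complex.norm_real]
          exact le_abs_self _
      _ = ‖(Ham dloc k N h ^ (2 * m)).trace‖ / (dloc : ℝ) ^ N := by
          rw [← (D N).trace_pow_div (2 * m), norm_div, norm_pow, Complex.norm_natCast]
      _ ≤ C * (N : ℝ) ^ m := by rwa [div_le_iff₀ (hdpos N)]
      _ ≤ max (c' ^ m) C * (N : ℝ) ^ m := by gcongr; exact le_max_right _ _
end

section
/- (Concentration of eigenvalues.) There exist constants C, c > 0 depending only on d_loc and k such that for every N ≥ k and every ε > 0, the number of indices j with |E_j| ≥ Nε satisfies |{j : |E_j| ≥ Nε}|/d ≤ C·e^{−c N ε²}, where {E_j}_{j=1}^{d} are the eigenvalues of H_N counted with multiplicity. -/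
open Matrix MeasureTheory Filter

/-- Peierls inequality for a matrix diagonalised by a unitary `W`. -/
lemma sum_exp_diag_conj_le {m p : Type*} [Fintype m] [DecidableEq m] [Fintype p] [DecidableEq p]
    (V : Matrix m m ℂ) (W : Matrix m p ℂ) (α : p → ℝ) (hV : Vᴴ * V = 1)
    (hW : Wᴴ * W = 1) (hW' : W * Wᴴ = 1) (t : ℝ) :
    ∑ j, Real.exp (t * ((Vᴴ * (W * diagonal (fun x => (α x : ℂ)) * Wᴴ) * V) j j).re) ≤
      ∑ x, Real.exp (t * α x) := by
  have hV' : V * Vᴴ = 1 := mul_eq_one_comm.mp hV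
  set M : Matrix p m ℂ := Wᴴ * V with hM
  have hMM : Mᴴ * M = 1 := by
    rw [hM, conjTranspose_mul, conjTranspose_conjTranspose, Matrix.mul_assoc,
      ← Matrix.mul_assoc W, hW', Matrix.one_mul, hV]
  have hMM' : M * Mᴴ = 1 := by
    rw [hM, conjTranspose_mul, conjTranspose_conjTranspose, Matrix.mul_assoc,
      ← Matrix.mul_assoc V, hV', Matrix.one_mul, hW]
  have hcol (j : m) : ∑ x, ‖M x j‖ ^ 2 = 1 := by
    have := congrFun (congrFun hMM j) j
    simp only [mul_apply, conjTranspose_apply, one_apply_eq, RCLike.star_def,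
      Complex.conj_mul'] at this
    exact_mod_cast this
  have hrow (x : p) : ∑ j, ‖M x j‖ ^ 2 = 1 := by
    have := congrFun (congrFun hMM' x) x
    simp only [mul_apply, conjTranspose_apply, one_apply_eq, RCLike.star_def,
      Complex.mul_conj'] at this
    exact_mod_cast this
  have hdiag (j : m) : ((Vᴴ * (W * diagonal (fun x => (α x : ℂ)) * Wᴴ) * V) j j).re =
      ∑ x, ‖M x j‖ ^ 2 * α x := by
    have : Vᴴ * (W * diagonal (fun x => (α x : ℂ)) * Wᴴ) * V =
        Mᴴ * (diagonal (fun x => (α x : ℂ)) * M) := by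
      simp only [hM, conjTranspose_mul, conjTranspose_conjTranspose, Matrix.mul_assoc]
    rw [this, mul_apply]
    have h2 : ∑ x, Mᴴ j x * (diagonal (fun x => (α x : ℂ)) * M) x j =
        ((∑ x, ‖M x j‖ ^ 2 * α x : ℝ) : ℂ) := by
      push_cast
      refine Finset.sum_congr rfl fun x _ => ?_
      rw [diagonal_mul, conjTranspose_apply, ← Complex.conj_mul', RCLike.star_def]
      ring
    rw [h2, Complex.ofReal_re]
  calc ∑ j, Real.exp (t * ((Vᴴ * (W * diagonal (fun x => (α x : ℂ)) * Wᴴ) * V) j j).re)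
      ≤ ∑ j, ∑ x, ‖M x j‖ ^ 2 * Real.exp (t * α x) := by
        refine Finset.sum_le_sum fun j _ => ?_
        have := convexOn_exp.map_sum_le (t := Finset.univ) (w := fun x => ‖M x j‖ ^ 2)
          (p := fun x => t * α x) (fun x _ => by positivity) (hcol j) (fun x _ => trivial)
        simp only [smul_eq_mul] at this
        rw [hdiag, Finset.mul_sum]
        refine le_trans (le_of_eq ?_) this
        congr 1
        exact Finset.sum_congr rfl fun x _ => by ring
    _ = ∑ x, Real.exp (t * α x) := by
        rw [Finset.sum_comm]
        exact Finset.sum_congr rfl fun x _ => by rw [← Finset.sum_mul, hrow, one_mul]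

/-- Hoeffding's lemma for the uniform average of finitely many numbers in `[-1, 1]`. -/
lemma sum_exp_le_card_mul_exp {κ : Type*} [Fintype κ] (e : κ → ℝ) (he : ∀ a, |e a| ≤ 1)
    (h0 : ∑ a, e a = 0) (t : ℝ) :
    ∑ a, Real.exp (t * e a) ≤ Fintype.card κ * Real.exp (t ^ 2 / 2) := by
  have key (a : κ) : Real.exp (t * e a) ≤ Real.cosh t + e a * Real.sinh t := by
    obtain ⟨h1, h2⟩ := abs_le.mp (he a)
    have : Real.exp ((1 + e a) / 2 * t + (1 - e a) / 2 * -t) ≤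
        (1 + e a) / 2 * Real.exp t + (1 - e a) / 2 * Real.exp (-t) :=
      convexOn_exp.2 (Set.mem_univ t) (Set.mem_univ (-t)) (by linarith) (by linarith) (by ring)
    rw [Real.cosh_eq, Real.sinh_eq]
    calc Real.exp (t * e a) = Real.exp ((1 + e a) / 2 * t + (1 - e a) / 2 * -t) := by
          congr 1; ring
      _ ≤ _ := this
      _ = _ := by ring
  calc ∑ a, Real.exp (t * e a) ≤ ∑ a, (Real.cosh t + e a * Real.sinh t) :=
        Finset.sum_le_sum fun a _ => key a
    _ = Fintype.card κ * Real.cosh t := by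
        rw [Finset.sum_add_distrib, ← Finset.sum_mul, h0]
        simp
    _ ≤ _ := by gcongr; exact Real.cosh_le_exp_half_sq t

/-- The operator `h` acting on the tensor factor `b`, in a tensor product of copies of `ℂ^κ`
indexed by `ι` and a further factor `ℂ^R`. -/
noncomputable def blockOp {κ ι R : Type*} [DecidableEq κ] [DecidableEq ι] [Fintype ι]
    [DecidableEq R] (h : Matrix κ κ ℂ) (b : ι) : Matrix ((ι → κ) × R) ((ι → κ) × R) ℂ :=
  fun x y => h (x.1 b) (y.1 b) * if (∀ b', b' ≠ b → x.1 b' = y.1 b') ∧ x.2 = y.2 then 1 else 0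

/-- The tensor product of copies of `U` on all the blocks, and the identity on `ℂ^R`. -/
noncomputable def tensorPow {κ ι R : Type*} [Fintype ι] [DecidableEq R] (U : Matrix κ κ ℂ) :
    Matrix ((ι → κ) × R) ((ι → κ) × R) ℂ :=
  fun x y => (∏ b, U (x.1 b) (y.1 b)) * if x.2 = y.2 then 1 else 0

lemma tensorPow_mul_diagonal_mul_apply {κ ι R : Type*} [Fintype κ] [DecidableEq κ] [Fintype ι]
    [DecidableEq ι] [Fintype R] [DecidableEq R] (U U' : Matrix κ κ ℂ) (f : ι → κ → ℂ)
    (y z : (ι → κ) × R) :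
    (tensorPow U * diagonal (fun x : (ι → κ) × R => ∏ b, f b (x.1 b)) * tensorPow U' :
      Matrix ((ι → κ) × R) ((ι → κ) × R) ℂ) y z =
      (∏ b, (U * diagonal (f b) * U') (y.1 b) (z.1 b)) * if y.2 = z.2 then 1 else 0 := by
  have hentry (b : ι) (i j : κ) :
      (U * diagonal (f b) * U') i j = ∑ a, U i a * f b a * U' a j := by
    rw [mul_apply]
    simp only [mul_diagonal]
  rw [mul_apply]
  simp only [mul_diagonal, tensorPow, Fintype.sum_prod_type, hentry]
  rw [Finset.prod_univ_sum, Finset.sum_mul, Fintype.piFinset_univ]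
  refine Finset.sum_congr rfl fun x _ => ?_
  simp only [Finset.prod_mul_distrib]
  rw [Finset.sum_eq_single y.2]
  · simp
  · intro r _ hr
    simp [hr.symm]
  · simp

lemma tensorPow_mul {κ ι R : Type*} [Fintype κ] [DecidableEq κ] [Fintype ι]
    [DecidableEq ι] [Fintype R] [DecidableEq R] {U U' : Matrix κ κ ℂ} (hU : U * U' = 1) :
    tensorPow (ι := ι) (R := R) U * tensorPow U' = 1 := by
  ext y z
  have := tensorPow_mul_diagonal_mul_apply U U' (fun _ _ => 1) y z
  simp only [Finset.prod_const_one, diagonal_one, Matrix.mul_one, hU] at this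
  rw [this]
  simp only [one_apply, Finset.prod_ite_zero, Finset.prod_const_one, Prod.ext_iff, funext_iff]
  by_cases h1 : ∀ b, y.1 b = z.1 b <;> by_cases h2 : y.2 = z.2 <;> simp [h1, h2]

lemma conjTranspose_tensorPow {κ ι R : Type*} [Fintype ι] [DecidableEq R] (U : Matrix κ κ ℂ) :
    (tensorPow (ι := ι) (R := R) U)ᴴ = tensorPow Uᴴ := by
  ext y z
  simp only [conjTranspose_apply, tensorPow, star_mul', star_prod]
  by_cases h : y.2 = z.2
  · simp [h]
  · simp [h, Ne.symm h]

lemma tensorPow_mul_diagonal_single_mul {κ ι R : Type*} [Fintype κ] [DecidableEq κ] [Fintype ι]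
    [DecidableEq ι] [Fintype R] [DecidableEq R] {U U' : Matrix κ κ ℂ} (hU : U * U' = 1)
    (g : κ → ℂ) (b : ι) :
    tensorPow (R := R) U * diagonal (fun x : (ι → κ) × R => g (x.1 b)) * tensorPow U' =
      blockOp (U * diagonal g * U') b := by
  ext y z
  have := tensorPow_mul_diagonal_mul_apply U U' (fun b' a => if b' = b then g a else 1) y z
  simp only [Finset.prod_ite_eq', Finset.mem_univ, if_true] at this
  rw [this]
  rw [blockOp, ← Finset.mul_prod_erase _ _ (Finset.mem_univ b), mul_assoc]
  congr 1
  · simp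
  · have : ∀ b' ∈ Finset.univ.erase b,
        (U * diagonal (fun a => if b' = b then g a else 1) * U') (y.1 b') (z.1 b') =
          if y.1 b' = z.1 b' then 1 else 0 := by
      intro b' hb'
      simp only [Finset.ne_of_mem_erase hb', if_false, diagonal_one, Matrix.mul_one, hU, one_apply]
    rw [Finset.prod_congr rfl this, Finset.prod_ite_zero]
    by_cases h1 : ∀ b', b' ≠ b → y.1 b' = z.1 b' <;> by_cases h2 : y.2 = z.2 <;> simp [h1, h2]

lemma abs_eigenvalues_le_opNorm {κ : Type*} [Fintype κ] [DecidableEq κ] {h : Matrix κ κ ℂ}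
    (hh : h.IsHermitian) (a : κ) : |hh.eigenvalues a| ≤ opNorm h := by
  have h1 := (Matrix.toEuclideanCLM (𝕜 := ℂ) (n := κ) h).le_opNorm (hh.eigenvectorBasis a)
  have h2 : Matrix.toEuclideanCLM (𝕜 := ℂ) (n := κ) h (hh.eigenvectorBasis a) =
      (hh.eigenvalues a : ℂ) • hh.eigenvectorBasis a := by
    apply (WithLp.ofLp_injective 2)
    rw [Matrix.ofLp_toEuclideanCLM, hh.mulVec_eigenvectorBasis]
    ext i
    simp
  rw [h2, norm_smul, (hh.eigenvectorBasis.orthonormal).1 a] at h1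
  simpa [opNorm] using h1

/-- Gaussian bound on the moment generating function of the diagonal entries, in any orthonormal
basis, of a sum of copies of a traceless contraction acting on disjoint blocks. -/
lemma sum_exp_blockOp_le {κ ι R m : Type*} [Fintype κ] [DecidableEq κ] [Fintype ι]
    [DecidableEq ι] [Fintype R] [DecidableEq R] [Fintype m] [DecidableEq m]
    (φ : m ≃ (ι → κ) × R) {h : Matrix κ κ ℂ} (hh : h.IsHermitian) (htr : h.trace = 0)
    (hnorm : opNorm h ≤ 1) (V : Matrix m m ℂ) (hV : Vᴴ * V = 1) (t : ℝ) :
    ∑ j, Real.exp (t * ((Vᴴ * (∑ b, blockOp h b).submatrix φ φ * V) j j).re) ≤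
      Fintype.card m * Real.exp (Fintype.card ι * (t ^ 2 / 2)) := by
  set U : Matrix κ κ ℂ := (hh.eigenvectorUnitary : Matrix κ κ ℂ)
  set e := hh.eigenvalues
  have hU : U * Uᴴ = 1 := Unitary.mul_star_self_of_mem hh.eigenvectorUnitary.2
  have hU' : Uᴴ * U = 1 := Unitary.star_mul_self_of_mem hh.eigenvectorUnitary.2
  have hspec : U * diagonal (fun a => (e a : ℂ)) * Uᴴ = h := by
    conv_rhs => rw [hh.spectral_theorem]
    rfl
  have he0 : ∑ a, e a = 0 := by
    have := hh.trace_eq_sum_eigenvalues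
    rw [htr, ← RCLike.ofReal_sum] at this
    exact RCLike.ofReal_eq_zero.mp this.symm
  set W : Matrix m ((ι → κ) × R) ℂ := (tensorPow U).submatrix φ id
  have hWc : Wᴴ = (tensorPow Uᴴ).submatrix id φ := by
    rw [conjTranspose_submatrix, conjTranspose_tensorPow]
  have hW : Wᴴ * W = 1 := by
    rw [hWc, submatrix_mul_equiv, tensorPow_mul hU', submatrix_id_id]
  have hW' : W * Wᴴ = 1 := by
    rw [hWc, ← submatrix_mul _ _ _ _ _ Function.bijective_id, tensorPow_mul hU,
      submatrix_one_equiv]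
  have hA : (∑ b, blockOp h b).submatrix φ φ =
      W * diagonal (fun x : (ι → κ) × R => ((∑ b, e (x.1 b) : ℝ) : ℂ)) * Wᴴ := by
    have h1 : (∑ b, blockOp h b : Matrix ((ι → κ) × R) _ ℂ) = tensorPow U *
        diagonal (fun x : (ι → κ) × R => ((∑ b, e (x.1 b) : ℝ) : ℂ)) * tensorPow Uᴴ := by
      have h2 : diagonal (fun x : (ι → κ) × R => ((∑ b, e (x.1 b) : ℝ) : ℂ)) =
          ∑ b, diagonal (fun x : (ι → κ) × R => (e (x.1 b) : ℂ)) := by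
        ext x y
        by_cases hxy : x = y
        · simp [hxy, Matrix.sum_apply]
        · simp [hxy, Matrix.sum_apply]
      rw [h2, Finset.mul_sum, Finset.sum_mul]
      refine Finset.sum_congr rfl fun b _ => ?_
      rw [tensorPow_mul_diagonal_single_mul hU (fun a => (e a : ℂ)), hspec]
    rw [h1, hWc, submatrix_mul _ _ _ id _ Function.bijective_id,
      submatrix_mul _ _ _ id _ Function.bijective_id, submatrix_id_id]
  rw [hA]
  refine (sum_exp_diag_conj_le V W _ hV hW hW' t).trans ?_
  calc ∑ x : (ι → κ) × R, Real.exp (t * ∑ b, e (x.1 b))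
      = Fintype.card R * ∏ _b : ι, ∑ a, Real.exp (t * e a) := by
        rw [Fintype.sum_prod_type, Finset.prod_univ_sum, Fintype.piFinset_univ, Finset.mul_sum]
        refine Finset.sum_congr rfl fun x _ => ?_
        simp [Finset.mul_sum, Real.exp_sum]
    _ ≤ Fintype.card R * ∏ _b : ι, (Fintype.card κ * Real.exp (t ^ 2 / 2)) := by
        gcongr
        exact sum_exp_le_card_mul_exp e (fun a => (abs_eigenvalues_le_opNorm hh a).trans hnorm)
          he0 t
    _ = _ := by
        rw [Fintype.card_congr φ, Fintype.card_prod, Fintype.card_fun, Finset.prod_const,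
          Finset.card_univ, mul_pow, ← Real.exp_nat_mul]
        push_cast
        ring

lemma Tmat_pow_apply (dloc N l : ℕ) (x y : Fin N → Fin dloc) :
    (Tmat dloc N ^ l) x y = if x = (confShift dloc N ^ l) y then 1 else 0 := by
  induction l generalizing x with
  | zero => simp [one_apply]
  | succ l ih =>
    rw [pow_succ', mul_apply]
    simp_rw [ih, Tmat, pow_succ', Equiv.Perm.mul_apply]
    simp only [mul_ite, mul_one, mul_zero, Finset.sum_ite_eq', Finset.mem_univ, if_true]
    congr

lemma Tmat_conjTranspose_mul_self (dloc N : ℕ) : (Tmat dloc N)ᴴ * Tmat dloc N = 1 := by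
  ext x y
  rw [mul_apply]
  simp [Tmat, one_apply, eq_comm]

lemma Tmat_pow_conj_apply (dloc N l : ℕ) (B : Op dloc N) (x y : Fin N → Fin dloc) :
    (Tmat dloc N ^ l * B * (Tmat dloc N)ᴴ ^ l) x y =
      B (x ∘ (finRotate N ^ l : Equiv.Perm (Fin N)))
        (y ∘ (finRotate N ^ l : Equiv.Perm (Fin N))) := by
  have hpow (l : ℕ) (z : Fin N → Fin dloc) :
      (confShift dloc N ^ l) (z ∘ (finRotate N ^ l : Equiv.Perm (Fin N))) = z := by
    induction l generalizing z with
    | zero => rfl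
    | succ l ih =>
      rw [pow_succ', Equiv.Perm.mul_apply]
      have : z ∘ (finRotate N ^ (l + 1) : Equiv.Perm (Fin N)) =
          (z ∘ finRotate N) ∘ (finRotate N ^ l : Equiv.Perm (Fin N)) := by
        rw [pow_succ']; rfl
      rw [this, ih]
      exact funext fun i => congrArg z ((finRotate N).apply_symm_apply i)
  have heq (z w : Fin N → Fin dloc) :
      z = (confShift dloc N ^ l) w ↔ w = z ∘ (finRotate N ^ l : Equiv.Perm (Fin N)) := by
    conv_lhs => rw [← hpow l z]
    rw [(confShift dloc N ^ l).injective.eq_iff, eq_comm]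
  rw [← conjTranspose_pow, mul_apply]
  simp_rw [mul_apply, conjTranspose_apply, Tmat_pow_apply, heq]
  simp

/-- The diagonal matrix elements are invariant under translation of the observable. -/
lemma eev_Tmat_pow_conj {dloc N : ℕ} {H : Op dloc N} (D : EigData dloc N H) (B : Op dloc N)
    (l : ℕ) (j : Fin N → Fin dloc) :
    eev D (Tmat dloc N ^ l * B * (Tmat dloc N)ᴴ ^ l) j = eev D B j := by
  have hT : (Tmat dloc N)ᴴ *ᵥ D.v j = (D.τ j)⁻¹ • D.v j ∧ star (D.τ j) * D.τ j = 1 := by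
    have h1 : D.v j = D.τ j • ((Tmat dloc N)ᴴ *ᵥ D.v j) := by
      rw [← mulVec_smul, ← D.eigT, mulVec_mulVec, Tmat_conjTranspose_mul_self, one_mulVec]
    have h2 : star (Tmat dloc N *ᵥ D.v j) ⬝ᵥ (Tmat dloc N *ᵥ D.v j) = 1 := by
      rw [star_mulVec, ← dotProduct_mulVec, mulVec_mulVec, Tmat_conjTranspose_mul_self,
        one_mulVec, D.orth, if_pos rfl]
    rw [D.eigT, star_smul, smul_dotProduct, dotProduct_smul, D.orth, if_pos rfl] at h2
    have h3 : star (D.τ j) * D.τ j = 1 := by simpa using h2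
    have h4 : D.τ j ≠ 0 := right_ne_zero_of_mul_eq_one h3
    refine ⟨?_, h3⟩
    conv_rhs => rw [h1]
    rw [smul_smul, inv_mul_cancel₀ h4, one_smul]
  induction l with
  | zero => simp
  | succ l ih =>
    rw [← ih, pow_succ', pow_succ]
    have : Tmat dloc N * Tmat dloc N ^ l * B * ((Tmat dloc N)ᴴ ^ l * (Tmat dloc N)ᴴ) =
        Tmat dloc N * (Tmat dloc N ^ l * B * (Tmat dloc N)ᴴ ^ l) * (Tmat dloc N)ᴴ := by
      simp only [Matrix.mul_assoc]
    rw [this]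
    set B' := Tmat dloc N ^ l * B * (Tmat dloc N)ᴴ ^ l
    have hst : star (D.v j) ᵥ* Tmat dloc N = star ((D.τ j)⁻¹) • star (D.v j) := by
      rw [← star_smul, ← hT.1, star_mulVec, conjTranspose_conjTranspose]
    rw [eev, eev, ← mulVec_mulVec, ← mulVec_mulVec, dotProduct_mulVec, hst, hT.1, mulVec_smul,
      smul_dotProduct, dotProduct_smul, smul_smul, star_inv₀, ← mul_inv, hT.2, inv_one, one_smul]

lemma eev_sum {dloc N : ℕ} {H : Op dloc N} (D : EigData dloc N H) {ι : Type*} (s : Finset ι)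
    (B : ι → Op dloc N) (j : Fin N → Fin dloc) :
    eev D (∑ i ∈ s, B i) j = ∑ i ∈ s, eev D (B i) j := by
  simp [eev, Matrix.sum_mulVec, dotProduct_sum]

lemma eev_self {dloc N : ℕ} {H : Op dloc N} (D : EigData dloc N H) (j : Fin N → Fin dloc) :
    eev D H j = D.E j := by
  rw [eev, D.eigH, dotProduct_smul, D.orth, if_pos rfl, smul_eq_mul, mul_one]

lemma E_eq_mul_eev {dloc k N : ℕ} {h : Op dloc k} (D : EigData dloc N (Ham dloc k N h))
    (j : Fin N → Fin dloc) : D.E j = N * (eev D (embed dloc k N h) j).re := by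
  have h1 : eev D (∑ l : Fin N, Tmat dloc N ^ (l : ℕ) * embed dloc k N h *
      (Tmat dloc N)ᴴ ^ (l : ℕ)) j = D.E j := eev_self D j
  rw [eev_sum] at h1
  simp_rw [eev_Tmat_pow_conj] at h1
  rw [← Complex.ofReal_re (D.E j), ← h1]
  simp

/-- The sites of a chain of length `N = n * k + r`, as `n` blocks of length `k` and `r` leftover
sites. -/
def siteEquiv {n k r N : ℕ} (hN : n * k + r = N) : (Fin n × Fin k) ⊕ Fin r ≃ Fin N :=
  (Equiv.sumCongr finProdFinEquiv (Equiv.refl _)).trans (finSumFinEquiv.trans (finCongr hN))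

/-- Configurations of the chain as configurations of the blocks and of the leftover sites. -/
def confEquiv (dloc : ℕ) {n k r N : ℕ} (hN : n * k + r = N) :
    (Fin N → Fin dloc) ≃ (Fin n → Fin k → Fin dloc) × (Fin r → Fin dloc) :=
  ((siteEquiv hN).symm.arrowCongr (Equiv.refl _)).trans
    ((Equiv.sumArrowEquivProdArrow _ _ _).trans
      ((Equiv.curry _ _ _).prodCongr (Equiv.refl _)))

lemma finRotate_pow_castLE {N k l : ℕ} (hkN : k ≤ N) (i : Fin k) (h : (i : ℕ) + l < N) :
    (((finRotate N ^ l) (Fin.castLE hkN i) : Fin N) : ℕ) = i + l := by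
  induction l with
  | zero => simp
  | succ l ih =>
    obtain ⟨M, rfl⟩ : ∃ M, N = M + 1 := ⟨N - 1, by omega⟩
    have ih' := ih (by omega)
    rw [pow_succ', Equiv.Perm.mul_apply, coe_finRotate_of_ne_last, ih', add_assoc]
    intro hl
    rw [hl, Fin.val_last] at ih'
    omega

lemma embed_apply (dloc : ℕ) {k N : ℕ} (hkN : k ≤ N) (h : Op dloc k) (x y : Fin N → Fin dloc) :
    embed dloc k N h x y =
      h (fun i => x (Fin.castLE hkN i)) (fun i => y (Fin.castLE hkN i)) *
        (if ∀ i : Fin N, k ≤ (i : ℕ) → x i = y i then 1 else 0) := by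
  have h1 : embed dloc k N h = fun x y : Fin N → Fin dloc =>
      h (fun i => x (Fin.castLE hkN i)) (fun i => y (Fin.castLE hkN i)) *
        (if ∀ i : Fin N, k ≤ (i : ℕ) → x i = y i then 1 else 0) := dif_pos hkN
  exact congrFun (congrFun h1 x) y

lemma Tmat_pow_conj_embed_s8 (dloc : ℕ) {n k r N : ℕ} (hN : n * k + r = N) (hkN : k ≤ N)
    (h : Op dloc k) (b : Fin n) :
    Tmat dloc N ^ ((b : ℕ) * k) * embed dloc k N h * (Tmat dloc N)ᴴ ^ ((b : ℕ) * k) =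
      (blockOp h b).submatrix (confEquiv dloc hN) (confEquiv dloc hN) := by
  set σ := finRotate N ^ ((b : ℕ) * k) with hσ
  have hbk (i : Fin k) : (i : ℕ) + b * k < N := by
    have : ((b : ℕ) + 1) * k ≤ n * k := Nat.mul_le_mul_right k b.2
    have := i.2
    rw [add_mul] at *
    omega
  have hsite (i : Fin k) : σ (Fin.castLE hkN i) = siteEquiv hN (.inl (b, i)) := by
    apply Fin.ext
    rw [hσ, finRotate_pow_castLE hkN i (hbk i)]
    simp [siteEquiv, mul_comm]
  ext x y
  rw [Tmat_pow_conj_apply, submatrix_apply, embed_apply dloc hkN, blockOp]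
  have hrest : (∀ i : Fin N, k ≤ (i : ℕ) → (x ∘ σ) i = (y ∘ σ) i) ↔
      (∀ b', b' ≠ b → (confEquiv dloc hN x).1 b' = (confEquiv dloc hN y).1 b') ∧
        (confEquiv dloc hN x).2 = (confEquiv dloc hN y).2 := by
    have hout (s : (Fin n × Fin k) ⊕ Fin r) (hs : ∀ i, s ≠ .inl (b, i)) :
        k ≤ ((σ.symm (siteEquiv hN s) : Fin N) : ℕ) := by
      by_contra! hlt
      have := hsite ⟨_, hlt⟩
      simp only [Fin.castLE_mk, Fin.eta, Equiv.apply_symm_apply] at this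
      exact hs _ ((siteEquiv hN).injective this)
    constructor
    · intro H
      have H' (s) (hs : ∀ i, s ≠ .inl (b, i)) : x (siteEquiv hN s) = y (siteEquiv hN s) := by
        simpa using H _ (hout s hs)
      refine ⟨fun b' hb' => funext fun i => H' (.inl (b', i)) ?_,
        funext fun i => H' (.inr i) ?_⟩
      · intro i' hi'
        simp only [Sum.inl.injEq, Prod.mk.injEq] at hi'
        exact hb' hi'.1
      · simp
    · rintro ⟨H1, H2⟩ i hi
      obtain ⟨s, hs⟩ := (siteEquiv hN).surjective (σ i)
      simp only [Function.comp_apply, ← hs]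
      rcases s with ⟨b', i'⟩ | s
      · refine congrFun (H1 b' ?_) i'
        rintro rfl
        rw [← hsite, σ.injective.eq_iff] at hs
        have := i'.2
        rw [← hs, Fin.val_castLE] at hi
        omega
      · exact congrFun H2 s
  congr 1
  · congr 1 <;> funext i
    · exact congrArg x (hsite i)
    · exact congrArg y (hsite i)
  · convert if_congr hrest rfl rfl

lemma sum_exp_eev_le {dloc n k r N : ℕ} (hN : n * k + r = N) (hkN : k ≤ N) {h : Op dloc k}
    (hh : h.IsHermitian) (htr : h.trace = 0) (hnorm : opNorm h ≤ 1)
    {H : Op dloc N} (D : EigData dloc N H) (t : ℝ) :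
    ∑ j, Real.exp (t * (n * (eev D (embed dloc k N h) j).re)) ≤
      (dloc : ℝ) ^ N * Real.exp (n * (t ^ 2 / 2)) := by
  set V : Op dloc N := Matrix.of fun x j => D.v j x
  have hentry (B : Op dloc N) (j : Fin N → Fin dloc) : (Vᴴ * B * V) j j = eev D B j := by
    rw [Matrix.mul_assoc, mul_apply, eev, dotProduct]
    rfl
  have hV : Vᴴ * V = 1 := by
    ext i j
    rw [one_apply, ← D.orth i j, mul_apply, dotProduct]
    rfl
  have := sum_exp_blockOp_le (confEquiv dloc hN) hh htr hnorm V hV t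
  have hsum : (∑ b, blockOp h b : Matrix ((Fin n → Fin k → Fin dloc) × (Fin r → Fin dloc)) _ ℂ
      ).submatrix (confEquiv dloc hN) (confEquiv dloc hN) =
      ∑ b : Fin n, Tmat dloc N ^ ((b : ℕ) * k) * embed dloc k N h *
        (Tmat dloc N)ᴴ ^ ((b : ℕ) * k) := by
    simp_rw [Tmat_pow_conj_embed_s8 dloc hN hkN]
    ext x y
    simp [Matrix.sum_apply]
  simp_rw [hsum, hentry, eev_sum, eev_Tmat_pow_conj] at this
  simpa using this

/-- concentration of eigenvalues: There exist constants `C, c > 0` depending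
only on `dloc` and `k` such that for every `N ≥ k` and every `ε > 0`, the fraction of
eigenvalues of `H_N` (with multiplicity) of modulus at least `Nε` is at most `C e^{-cNε²}`. -/
theorem eigenvalue_concentration (dloc k : ℕ) (hdloc : 2 ≤ dloc) (hk : 1 ≤ k) :
    ∃ C c : ℝ, 0 < C ∧ 0 < c ∧
      ∀ h : Op dloc k, h.IsHermitian → h.trace = 0 → opNorm h = 1 →
      ∀ N : ℕ, k ≤ N → ∀ D : EigData dloc N (Ham dloc k N h), ∀ ε : ℝ, 0 < ε →
        ((Finset.univ.filter fun j => (N : ℝ) * ε ≤ |D.E j|).card : ℝ) / (dloc : ℝ) ^ N ≤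
          C * Real.exp (-(c * N * ε ^ 2)) := by
  refine ⟨2, 1 / (4 * k), by norm_num, by positivity, ?_⟩
  intro h hh htr hnorm N hkN D ε hε
  set n := N / k
  have hN : n * k + N % k = N := Nat.div_add_mod' N k
  have hn : 0 < n := Nat.div_pos hkN hk
  have hNn : (N : ℝ) ≤ 2 * k * n := by
    have h1 : N % k < k := Nat.mod_lt _ hk
    have h2 : k ≤ n * k := Nat.le_mul_of_pos_left k hn
    have h3 : N ≤ 2 * k * n := by nlinarith
    exact_mod_cast h3
  have hN0 : (0 : ℝ) < N := by exact_mod_cast lt_of_lt_of_le hk hkN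
  have hd : (0 : ℝ) < (dloc : ℝ) ^ N := by positivity
  set a := fun j => (n : ℝ) * (eev D (embed dloc k N h) j).re
  have hpos := sum_exp_eev_le hN hkN hh htr hnorm.le D ε
  have hneg := sum_exp_eev_le hN hkN hh htr hnorm.le D (-ε)
  rw [neg_sq] at hneg
  set S := Finset.univ.filter fun j => (N : ℝ) * ε ≤ |D.E j|
  have hcount : (S.card : ℝ) * Real.exp (n * ε ^ 2) ≤
      ∑ j, (Real.exp (ε * a j) + Real.exp (-ε * a j)) := by
    rw [← nsmul_eq_mul]
    refine (Finset.card_nsmul_le_sum S _ _ fun j hj => ?_).trans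
      (Finset.sum_le_sum_of_subset_of_nonneg (Finset.subset_univ S)
        fun j _ _ => by positivity)
    have hj' : (N : ℝ) * ε ≤ |D.E j| := (Finset.mem_filter.mp hj).2
    rw [E_eq_mul_eev, abs_mul, Nat.abs_cast] at hj'
    have hj2 : ε ≤ |(eev D (embed dloc k N h) j).re| := le_of_mul_le_mul_left hj' hN0
    have hj3 : n * ε ^ 2 ≤ |ε * a j| := by
      rw [abs_mul, abs_mul, Nat.abs_cast, abs_of_pos hε]
      calc (n : ℝ) * ε ^ 2 = ε * (n * ε) := by ring
        _ ≤ _ := by gcongr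
    rw [neg_mul]
    rcases le_abs'.mp hj3 with h1 | h1
    · exact (Real.exp_le_exp.mpr (le_neg_of_le_neg h1)).trans
        (le_add_of_nonneg_left (Real.exp_pos _).le)
    · exact (Real.exp_le_exp.mpr h1).trans (le_add_of_nonneg_right (Real.exp_pos _).le)
  rw [Finset.sum_add_distrib] at hcount
  have htotal : (S.card : ℝ) * Real.exp (n * ε ^ 2) ≤
      2 * (dloc : ℝ) ^ N * Real.exp (n * (ε ^ 2 / 2)) := by linarith
  have hexp : Real.exp (n * (ε ^ 2 / 2)) ≤
      Real.exp (-(1 / (4 * k) * N * ε ^ 2)) * Real.exp (n * ε ^ 2) := by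
    rw [← Real.exp_add, Real.exp_le_exp]
    have hk0 : (0 : ℝ) < k := by exact_mod_cast hk
    have h1 : 1 / (4 * k) * (N : ℝ) ≤ n / 2 := by
      rw [div_mul_eq_mul_div, one_mul, div_le_iff₀ (by positivity)]
      linarith
    nlinarith [mul_le_mul_of_nonneg_right h1 (sq_nonneg ε)]
  rw [div_le_iff₀ hd]
  refine le_of_mul_le_mul_right (htotal.trans ?_) (Real.exp_pos (n * ε ^ 2))
  calc 2 * (dloc : ℝ) ^ N * Real.exp (n * (ε ^ 2 / 2))
      ≤ 2 * (dloc : ℝ) ^ N *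
        (Real.exp (-(1 / (4 * k) * N * ε ^ 2)) * Real.exp (n * ε ^ 2)) := by gcongr
    _ = _ := by ring
end
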